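/- arXiv:1309.0571 — 2 statements merged into one kernel-verified Lean document; each statement's English description precedes it below -/
import Mathlib

section
/- Let G be a group and let N be a normal subgroup of G such that the quotient group G/N satisfies the maximal condition on normal subgroups (every nonempty family of normal subgroups of G/N has a maximal element). Then for every integer t ≥ 1 there exists a characteristic subgroup H of G such that: (1) H belongs to the sublattice of the subgroup lattice of G generated by the images φ(N) of N under all automorphisms φ of G (in particular H is normal in G); (2) for every class 𝓕 of groups which is a formation and contains G/N, the quotient group G/H lies in 𝓕; (3) for every outer commutator word w of weight k with k ≤ t and every radical class 𝓡 of groups containing the group w(N,…,N), the group w(H,…,H) lies in 𝓡. -/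
universe u

/-- A *class of groups*: a predicate on groups in a fixed universe. -/
abbrev GroupClass : Type (u + 1) := ∀ (H : Type u) [Group H], Prop

/-- A class of groups is invariant under group isomorphism. -/
def IsoClosed (C : GroupClass.{u}) : Prop :=
  ∀ (A B : Type u) [Group A] [Group B], (A ≃* B) → C A → C B

/-- A class of groups is *radical* if it is closed under normal subgroups and under
products of two normal subgroups. -/
def IsRadicalClass (C : GroupClass.{u}) : Prop :=
  (∀ (A : Type u) [Group A] (K : Subgroup A), K.Normal → C A → C ↥K) ∧
  (∀ (A : Type u) [Group A] (K₁ K₂ : Subgroup A), K₁.Normal → K₂.Normal →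
    K₁ ⊔ K₂ = ⊤ → C ↥K₁ → C ↥K₂ → C A)

/-- A class of groups is a *formation* if it is closed under quotients and under
subdirect products of two groups. -/
def IsFormation (C : GroupClass.{u}) : Prop :=
  (∀ (A : Type u) [Group A] (K : Subgroup A) [K.Normal], C A → C (A ⧸ K)) ∧
  (∀ (A B : Type u) [Group A] [Group B] (K : Subgroup (A × B)),
    (Function.Surjective fun k : ↥K => (k : A × B).1) →
    (Function.Surjective fun k : ↥K => (k : A × B).2) →
    C A → C B → C ↥K)

/-- `quotLies C K hK` says that the quotient group `G/K` lies in the class `C`. -/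
def quotLies (C : GroupClass.{u}) {G : Type u} [Group G]
    (K : Subgroup G) (hK : K.Normal) : Prop :=
  haveI := hK
  C (G ⧸ K)

/-- Full binary trees encoding outer commutator words. -/
inductive CTree : Type
  | leaf : CTree
  | node : CTree → CTree → CTree

/-- The weight (number of leaves) of an outer commutator word. -/
def CTree.weight : CTree → ℕ
  | .leaf => 1
  | .node a b => a.weight + b.weight

/-- The verbal subgroup `w_T(N₁,…,N_t)` associated with an outer commutator word `T`:
a leaf gives the argument itself, and a node gives the commutator subgroup of the values
of the two subtrees on the corresponding blocks of arguments. -/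
def CTree.sub {G : Type*} [Group G] :
    (T : CTree) → (Fin T.weight → Subgroup G) → Subgroup G
  | .leaf, N => N ⟨0, Nat.one_pos⟩
  | .node a b, N =>
      ⁅a.sub (fun i => N (Fin.castAdd b.weight i)),
        b.sub (fun i => N (Fin.natAdd a.weight i))⁆

section helpers

/-- Maximal condition on normal subgroups containing `M`. -/
def MaxN {G : Type u} [Group G] (M : Subgroup G) : Prop :=
  ∀ S : Set (Subgroup G), S.Nonempty → (∀ K ∈ S, K.Normal ∧ M ≤ K) →
    ∃ K ∈ S, ∀ K' ∈ S, K ≤ K' → K' = K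

/-- Membership in the sublattice generated by the automorphic images of `N`. -/
def InLat {G : Type u} [Group G] (N H : Subgroup G) : Prop :=
  ∀ S : Set (Subgroup G), (∀ φ : G ≃* G, N.map φ.toMonoidHom ∈ S) →
        (∀ a ∈ S, ∀ b ∈ S, a ⊔ b ∈ S) → (∀ a ∈ S, ∀ b ∈ S, a ⊓ b ∈ S) → H ∈ S

/-- Properties maintained along the construction. -/
structure Good {G : Type u} [Group G] (N : Subgroup G) (hN : N.Normal) (M : Subgroup G) :
    Prop where
  nor : M.Normal
  lat : InLat N M
  form : ∀ C : GroupClass.{u}, IsoClosed C → IsFormation C →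
          quotLies C N hN → quotLies C M nor
  max : MaxN M

variable {G : Type u} [Group G]

theorem map_normal {M : Subgroup G} (h : M.Normal) (φ : G ≃* G) :
    (M.map φ.toMonoidHom).Normal := h.map _ φ.surjective

theorem le_of_modular {A B M : Subgroup G} (hM : M.Normal) (hAB : A ≤ B)
    (h1 : B ≤ A ⊔ M) (h2 : B ⊓ M ≤ A) : B ≤ A := by
  intro x hx
  obtain ⟨a, ha, m, hm, rfl⟩ := Subgroup.mem_sup_of_normal_right.1 (h1 hx)
  refine A.mul_mem ha (h2 ⟨?_, hm⟩)
  have := B.mul_mem (B.inv_mem (hAB ha)) hx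
  simpa using this

theorem MaxN.inf {M₁ M₂ : Subgroup G} (n₁ : M₁.Normal) (n₂ : M₂.Normal)
    (h₁ : MaxN M₁) (h₂ : MaxN M₂) : MaxN (M₁ ⊓ M₂) := by
  intro S hS hSn
  obtain ⟨_, ⟨K₀, hK₀, rfl⟩, hmax₀⟩ := h₁ ((fun K => K ⊔ M₁) '' S) (hS.image _) (by
    rintro _ ⟨K, hK, rfl⟩
    have := (hSn K hK).1
    exact ⟨inferInstance, le_sup_right⟩)
  obtain ⟨_, ⟨K, ⟨hK, hKe⟩, rfl⟩, hmax₁⟩ := h₂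
    ((fun K => (K ⊓ M₁) ⊔ M₂) '' {K | K ∈ S ∧ K ⊔ M₁ = K₀ ⊔ M₁}) ⟨_, K₀, ⟨hK₀, rfl⟩, rfl⟩ (by
    rintro _ ⟨K, ⟨hK, -⟩, rfl⟩
    have := (hSn K hK).1
    exact ⟨inferInstance, le_sup_right⟩)
  refine ⟨K, hK, fun K' hK' hle => le_antisymm ?_ hle⟩
  have e1 : K' ⊔ M₁ = K₀ ⊔ M₁ := hmax₀ _ ⟨K', hK', rfl⟩ (by
    show K₀ ⊔ M₁ ≤ K' ⊔ M₁
    rw [← hKe]; exact sup_le_sup_right hle _)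
  have e2 : (K' ⊓ M₁) ⊔ M₂ = (K ⊓ M₁) ⊔ M₂ := hmax₁ _ ⟨K', ⟨hK', e1⟩, rfl⟩
    (sup_le_sup_right (inf_le_inf_right _ hle) _)
  apply le_of_modular n₁ hle
  · rw [hKe, ← e1]; exact le_sup_left
  · refine le_trans ?_ (inf_le_left : K ⊓ M₁ ≤ K)
    apply le_of_modular n₂ (inf_le_inf_right _ hle)
    · rw [← e2]; exact le_sup_left
    · refine le_inf (le_trans (inf_le_inf_right _ inf_le_right) (hSn K hK).2)
        (inf_le_left.trans inf_le_right)

theorem MaxN.map {M : Subgroup G} (h : MaxN M) (φ : G ≃* G) :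
    MaxN (M.map φ.toMonoidHom) := by
  intro S hS hSn
  obtain ⟨_, ⟨K, hK, rfl⟩, hm⟩ := h ((fun K => K.comap φ.toMonoidHom) '' S) (hS.image _) (by
    rintro _ ⟨K, hK, rfl⟩
    exact ⟨(hSn K hK).1.comap _, Subgroup.map_le_iff_le_comap.1 (hSn K hK).2⟩)
  refine ⟨K, hK, fun K' hK' hle => ?_⟩
  exact Subgroup.comap_injective (f := φ.toMonoidHom) φ.surjective
    (hm _ ⟨K', hK', rfl⟩ (Subgroup.comap_mono hle))

theorem MaxN.base {N : Subgroup G} [hN : N.Normal]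
    (hmax : ∀ S : Set (Subgroup (G ⧸ N)), S.Nonempty → (∀ K ∈ S, K.Normal) →
      ∃ K ∈ S, ∀ K' ∈ S, K ≤ K' → K' = K) : MaxN N := by
  intro S hS hSn
  obtain ⟨_, ⟨K, hK, rfl⟩, hm⟩ := hmax ((fun K => K.map (QuotientGroup.mk' N)) '' S)
    (hS.image _) (by
    rintro _ ⟨K, hK, rfl⟩
    exact (hSn K hK).1.map _ (QuotientGroup.mk'_surjective N))
  refine ⟨K, hK, fun K' hK' hle => ?_⟩
  have := congrArg (Subgroup.comap (QuotientGroup.mk' N))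
    (hm _ ⟨K', hK', rfl⟩ (Subgroup.map_mono hle))
  simpa [Subgroup.comap_map_eq, (hSn K hK).2, (hSn K' hK').2] using this

theorem form_map {C : GroupClass.{u}} (hC : IsoClosed C) {M : Subgroup G} (hM : M.Normal)
    (φ : G ≃* G) (h : quotLies C M hM) : quotLies C (M.map φ.toMonoidHom) (map_normal hM φ) := by
  have := hM
  have := map_normal hM φ
  exact hC _ _ (QuotientGroup.congr M (M.map φ.toMonoidHom) φ rfl) h

theorem form_inf {C : GroupClass.{u}} (hC : IsoClosed C) (hF : IsFormation C)
    {A B : Subgroup G} (hA : A.Normal) (hB : B.Normal) (hAB : (A ⊓ B).Normal)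
    (h1 : quotLies C A hA) (h2 : quotLies C B hB) : quotLies C (A ⊓ B) hAB := by
  let f : G →* (G ⧸ A) × (G ⧸ B) := (QuotientGroup.mk' A).prod (QuotientGroup.mk' B)
  have hk : f.ker = A ⊓ B := by
    ext x
    simp [f, MonoidHom.mem_ker, Prod.ext_iff, Subgroup.mem_inf]
  have hr : C f.range := by
    refine hF.2 (G ⧸ A) (G ⧸ B) f.range ?_ ?_ h1 h2
    · intro x
      obtain ⟨g, rfl⟩ := QuotientGroup.mk'_surjective A x
      exact ⟨⟨f g, g, rfl⟩, rfl⟩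
    · intro x
      obtain ⟨g, rfl⟩ := QuotientGroup.mk'_surjective B x
      exact ⟨⟨f g, g, rfl⟩, rfl⟩
  have e1 := (QuotientGroup.quotientKerEquivRange f).symm
  have e2 : G ⧸ f.ker ≃* G ⧸ (A ⊓ B) := QuotientGroup.quotientMulEquivOfEq hk
  exact hC _ _ (e1.trans e2) hr

theorem form_mono {C : GroupClass.{u}} (hC : IsoClosed C) (hF : IsFormation C)
    {A B : Subgroup G} (hA : A.Normal) (hB : B.Normal) (hAB : A ≤ B)
    (h1 : quotLies C A hA) : quotLies C B hB := by
  have := hF.1 (G ⧸ A) (B.map (QuotientGroup.mk' A)) h1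
  exact hC _ _ (QuotientGroup.quotientQuotientEquivQuotient A B hAB) this

theorem InLat.map {N M : Subgroup G} (h : InLat N M) (φ : G ≃* G) :
    InLat N (M.map φ.toMonoidHom) := by
  intro S h1 h2 h3
  refine h {K | K.map φ.toMonoidHom ∈ S} ?_ ?_ ?_
  · intro ψ
    have := h1 (ψ.trans φ)
    show (N.map ψ.toMonoidHom).map φ.toMonoidHom ∈ S
    rw [Subgroup.map_map]
    exact this
  · intro a ha b hb
    show (a ⊔ b).map φ.toMonoidHom ∈ S
    rw [Subgroup.map_sup]; exact h2 _ ha _ hb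
  · intro a ha b hb
    show (a ⊓ b).map φ.toMonoidHom ∈ S
    rw [Subgroup.map_inf _ _ _ φ.injective]; exact h3 _ ha _ hb

theorem Good.map {N : Subgroup G} {hN : N.Normal} {M : Subgroup G} (h : Good N hN M)
    (φ : G ≃* G) : Good N hN (M.map φ.toMonoidHom) :=
  ⟨map_normal h.nor φ, h.lat.map φ, fun C hC hF hq => form_map hC h.nor φ (h.form C hC hF hq),
    h.max.map φ⟩

theorem Good.inf {N : Subgroup G} {hN : N.Normal} {A B : Subgroup G} (hA : Good N hN A)
    (hB : Good N hN B) : Good N hN (A ⊓ B) := by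
  have := hA.nor
  have := hB.nor
  exact ⟨inferInstance, fun S h1 h2 h3 => h3 _ (hA.lat S h1 h2 h3) _ (hB.lat S h1 h2 h3),
    fun C hC hF hq => form_inf hC hF _ _ _ (hA.form C hC hF hq) (hB.form C hC hF hq),
    MaxN.inf hA.nor hB.nor hA.max hB.max⟩

theorem Good.finf {N : Subgroup G} {hN : N.Normal} {M : Subgroup G} (h : Good N hN M)
    (F : Finset (G ≃* G)) :
    Good N hN (M ⊓ F.inf fun φ => M.map φ.toMonoidHom) := by
  classical
  induction F using Finset.induction_on with
  | empty => simpa using h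
  | insert φ F _ ih =>
    rw [Finset.inf_insert, inf_left_comm]
    exact (h.map φ).inf ih

theorem fsup_lat {N : Subgroup G} {M : Subgroup G} (h : InLat N M) (F : Finset (G ≃* G)) :
    InLat N (M ⊔ F.sup fun φ => M.map φ.toMonoidHom) := by
  classical
  induction F using Finset.induction_on with
  | empty => simpa using h
  | insert φ F _ ih =>
    rw [Finset.sup_insert, sup_left_comm]
    exact fun S h1 h2 h3 => h2 _ (h.map φ S h1 h2 h3) _ (ih S h1 h2 h3)

theorem fsup_normal {M : Subgroup G} (h : M.Normal) (F : Finset (G ≃* G)) :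
    (M ⊔ F.sup fun φ => M.map φ.toMonoidHom).Normal := by
  classical
  induction F using Finset.induction_on with
  | empty => simpa using h
  | insert φ F _ ih =>
    rw [Finset.sup_insert, sup_left_comm]
    have := map_normal h φ
    exact Subgroup.sup_normal _ _

/-- The join of all automorphic images. -/
def autSup (M : Subgroup G) : Subgroup G := ⨆ φ : G ≃* G, M.map φ.toMonoidHom

theorem le_autSup (M : Subgroup G) : M ≤ autSup M :=
  le_trans (by
    show M ≤ M.map (MulEquiv.refl G).toMonoidHom
    intro x hx
    exact ⟨x, hx, rfl⟩) (le_iSup (fun φ : G ≃* G => M.map φ.toMonoidHom) (MulEquiv.refl G))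

theorem autSup_char (M : Subgroup G) : (autSup M).Characteristic := by
  rw [Subgroup.characteristic_iff_map_le]
  intro φ
  unfold autSup
  rw [Subgroup.map_iSup]
  refine iSup_le fun ψ => ?_
  rw [Subgroup.map_map]
  exact le_iSup (fun φ : G ≃* G => M.map φ.toMonoidHom) (ψ.trans φ)

theorem autSup_finite {M : Subgroup G} (hn : M.Normal) (h : MaxN M) :
    ∃ F : Finset (G ≃* G), autSup M = M ⊔ F.sup fun φ => M.map φ.toMonoidHom := by
  classical
  obtain ⟨_, ⟨F, rfl⟩, hm⟩ := h
    (Set.range fun F : Finset (G ≃* G) => M ⊔ F.sup fun φ => M.map φ.toMonoidHom)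
    (Set.range_nonempty _) (by
      rintro _ ⟨F, rfl⟩
      exact ⟨fsup_normal hn F, le_sup_left⟩)
  refine ⟨F, le_antisymm (iSup_le fun φ => ?_) (sup_le (le_autSup M) (Finset.sup_le fun φ _ =>
    le_iSup (fun φ : G ≃* G => M.map φ.toMonoidHom) φ))⟩
  have := hm _ ⟨insert φ F, rfl⟩ (sup_le_sup_left (Finset.sup_mono (Finset.subset_insert _ _)) _)
  simp only at this
  rw [← this]
  exact le_trans (Finset.le_sup (f := fun φ : G ≃* G => M.map φ.toMonoidHom)
    (Finset.mem_insert_self φ F)) le_sup_right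

open scoped commutatorElement in
theorem comm_iSup_le {ι : Type*} (A : ι → Subgroup G) (B : Subgroup G)
    (hA : ∀ k, (A k).Normal) (hB : B.Normal) : ⁅⨆ k, A k, B⁆ ≤ ⨆ k, ⁅A k, B⁆ := by
  have hR : (⨆ k, ⁅A k, B⁆).Normal := by
    have : ∀ k, (⁅A k, B⁆).Normal := fun k => by have := hA k; infer_instance
    infer_instance
  rw [Subgroup.commutator_le]
  intro g hg b hb
  induction hg using Subgroup.iSup_induction' with
  | hp k x hx => exact le_iSup (fun k => ⁅A k, B⁆) k (Subgroup.commutator_mem_commutator hx hb)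
  | h1 => simp
  | hmul x y _ _ hx hy =>
    have : ⁅x * y, b⁆ = x * ⁅y, b⁆ * x⁻¹ * ⁅x, b⁆ := by
      simp only [commutatorElement_def]; group
    rw [this]
    exact Subgroup.mul_mem _ (hR.conj_mem _ hy x) hx

theorem sub_normal (T : CTree) (f : Fin T.weight → Subgroup G) (hf : ∀ i, (f i).Normal) :
    (T.sub f).Normal := by
  induction T with
  | leaf => exact hf _
  | node a b iha ihb =>
    have := iha (fun i => f (Fin.castAdd b.weight i)) (fun i => hf _)
    have := ihb (fun i => f (Fin.natAdd a.weight i)) (fun i => hf _)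
    unfold CTree.sub
    infer_instance

theorem sub_mono (T : CTree) (f g : Fin T.weight → Subgroup G) (h : ∀ i, f i ≤ g i) :
    T.sub f ≤ T.sub g := by
  induction T with
  | leaf => exact h _
  | node a b iha ihb =>
    exact Subgroup.commutator_mono (iha _ _ fun i => h _) (ihb _ _ fun i => h _)

theorem sub_map (T : CTree) (f : Fin T.weight → Subgroup G) (φ : G ≃* G) :
    (T.sub f).map φ.toMonoidHom = T.sub (fun i => (f i).map φ.toMonoidHom) := by
  induction T with
  | leaf => rfl
  | node a b iha ihb =>
    unfold CTree.sub
    rw [Subgroup.map_commutator, iha, ihb]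

theorem sub_iSup_le {ι : Type*} (T : CTree) (f : Fin T.weight → Subgroup G)
    (g : ι → Fin T.weight → Subgroup G) (hf : ∀ i, (f i).Normal) (hg : ∀ k i, (g k i).Normal)
    (p : Fin T.weight) (hp : f p ≤ ⨆ k, g k p) (h : ∀ k i, i ≠ p → f i ≤ g k i) :
    T.sub f ≤ ⨆ k, T.sub (g k) := by
  induction T with
  | leaf =>
    have : p = ⟨0, Nat.one_pos⟩ := Subsingleton.elim (α := Fin 1) _ _
    subst this
    exact hp
  | node a b iha ihb =>
    have nA := fun k => sub_normal a (fun i => g k (Fin.castAdd b.weight i)) (fun i => hg _ _)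
    have nB := fun k => sub_normal b (fun i => g k (Fin.natAdd a.weight i)) (fun i => hg _ _)
    have mA := sub_normal a (fun i => f (Fin.castAdd b.weight i)) (fun i => hf _)
    have mB := sub_normal b (fun i => f (Fin.natAdd a.weight i)) (fun i => hf _)
    unfold CTree.sub
    have key : ∀ q : Fin (a.weight + b.weight), q = p → 
      ⁅a.sub (fun i => f (Fin.castAdd b.weight i)), b.sub (fun i => f (Fin.natAdd a.weight i))⁆ ≤
      ⨆ k, ⁅a.sub (fun i => g k (Fin.castAdd b.weight i)),
        b.sub (fun i => g k (Fin.natAdd a.weight i))⁆ := by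
      intro q
      refine Fin.addCases (fun q => ?_) (fun q => ?_) q
      · intro hq
        subst hq
        have h1 := iha (fun i => f (Fin.castAdd b.weight i))
          (fun k i => g k (Fin.castAdd b.weight i)) (fun i => hf _) (fun k i => hg _ _) q hp
          (fun k i hi => h k _ (fun e => hi (Fin.castAdd_injective _ _ e)))
        refine (Subgroup.commutator_mono h1 le_rfl).trans ((comm_iSup_le _ _ nA mB).trans
          (iSup_mono fun k => Subgroup.commutator_mono le_rfl (sub_mono _ _ _ fun i => h k _ ?_)))
        intro e
        have := congrArg Fin.val e
        simp at this
        omega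
      · intro hq
        subst hq
        have h1 := ihb (fun i => f (Fin.natAdd a.weight i))
          (fun k i => g k (Fin.natAdd a.weight i)) (fun i => hf _) (fun k i => hg _ _) q hp
          (fun k i hi => h k _ (fun e => hi (Fin.natAdd_injective _ _ e)))
        rw [Subgroup.commutator_comm]
        refine (Subgroup.commutator_mono h1 le_rfl).trans ((comm_iSup_le _ _ nB mA).trans
          (iSup_mono fun k => ?_))
        rw [Subgroup.commutator_comm]
        refine Subgroup.commutator_mono (sub_mono _ _ _ fun i => h k _ ?_) le_rfl
        intro e
        have := congrArg Fin.val e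
        simp at this
        omega
    exact key p rfl

theorem rad_mono {C : GroupClass.{u}} (hC : IsoClosed C) (hR : IsRadicalClass C)
    {K L : Subgroup G} (hK : K.Normal) (hKL : K ≤ L) (h : C L) : C K :=
  hC _ _ (Subgroup.subgroupOfEquivOfLe hKL) (hR.1 L (K.subgroupOf L) inferInstance h)

theorem rad_sup {C : GroupClass.{u}} (hC : IsoClosed C) (hR : IsRadicalClass C)
    {K L : Subgroup G} (hK : K.Normal) (hL : L.Normal) (h1 : C K) (h2 : C L) :
    C ↥(K ⊔ L) := by
  refine hR.2 _ (K.subgroupOf (K ⊔ L)) (L.subgroupOf (K ⊔ L)) inferInstance inferInstance ?_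
    (hC _ _ (Subgroup.subgroupOfEquivOfLe le_sup_left).symm h1)
    (hC _ _ (Subgroup.subgroupOfEquivOfLe le_sup_right).symm h2)
  rw [← Subgroup.subgroupOf_sup le_sup_left le_sup_right, Subgroup.subgroupOf_self]

theorem rad_fsup {ι : Type*} {C : GroupClass.{u}} (hC : IsoClosed C) (hR : IsRadicalClass C)
    (A : ι → Subgroup G) (hA : ∀ k, (A k).Normal) (F : Finset ι) (h0 : C ↥(⊥ : Subgroup G))
    (h : ∀ k ∈ F, C (A k)) : C ↥(F.sup A) ∧ (F.sup A).Normal := by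
  classical
  induction F using Finset.induction_on with
  | empty => exact ⟨by rw [Finset.sup_empty]; exact h0, by rw [Finset.sup_empty]; infer_instance⟩
  | insert k F _ ih =>
    obtain ⟨i1, i2⟩ := ih fun k hk => h k (Finset.mem_insert_of_mem hk)
    have := hA k
    rw [Finset.sup_insert]
    exact ⟨rad_sup hC hR (hA k) i2 (h k (Finset.mem_insert_self _ _)) i1, inferInstance⟩

theorem steps (N : Subgroup G) (hN : N.Normal) (hmax : MaxN N) (j : ℕ) :
    ∃ (S : ℕ → Subgroup G) (M : Subgroup G), Good N hN M ∧
      (∀ i, (S i).Characteristic) ∧ (∀ i < j, M ≤ S i) ∧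
      ∀ (T : CTree) (C : GroupClass.{u}), IsoClosed C → IsRadicalClass C →
        C ↥(T.sub fun _ => N) → C ↥(T.sub fun i => if i.1 < j then S i.1 else M) := by
  classical
  induction j with
  | zero =>
    refine ⟨fun _ => ⊤, N, ⟨hN, ?_, fun C _ _ h => h, hmax⟩, fun i => inferInstance,
      fun i hi => absurd hi (Nat.not_lt_zero _), fun T C _ _ h => by
      have e : (fun i : Fin T.weight => if i.1 < 0 then (⊤ : Subgroup G) else N) = fun _ => N :=
        funext fun i => if_neg (Nat.not_lt_zero _)
      show C ↥(T.sub fun i : Fin T.weight => if i.1 < 0 then (⊤ : Subgroup G) else N)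
      rw [e]
      exact h⟩
    intro S h1 _ _
    have := h1 (MulEquiv.refl G)
    rwa [show N.map (MulEquiv.refl G).toMonoidHom = N from Subgroup.map_id N] at this
  | succ j ih =>
    obtain ⟨S, M, hM, hSc, hMS, hrad⟩ := ih
    obtain ⟨F₀, hF₀⟩ := autSup_finite hM.nor hM.max
    let F : Finset (G ≃* G) := insert (MulEquiv.refl G) F₀
    have hid : M.map (MulEquiv.refl G).toMonoidHom = M := Subgroup.map_id M
    have hF : autSup M = F.sup fun φ => M.map φ.toMonoidHom := by
      rw [hF₀, Finset.sup_insert, hid]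
    let M' := M ⊓ F.inf fun φ => M.map φ.toMonoidHom
    have hM' : Good N hN M' := hM.finf F
    have hM'F : ∀ φ ∈ F, M' ≤ M.map φ.toMonoidHom := fun φ hφ =>
      inf_le_right.trans (Finset.inf_le hφ)
    let S' := Function.update S j (autSup M)
    have hS'c : ∀ i, (S' i).Characteristic := by
      intro i
      by_cases hi : i = j
      · subst hi; simp only [S', Function.update_self]; exact autSup_char M
      · simp only [S', Function.update_of_ne hi]; exact hSc i
    refine ⟨S', M', hM', hS'c, ?_, ?_⟩
    · intro i hi
      by_cases hij : i = j
      · subst hij; simp only [S', Function.update_self]; exact inf_le_left.trans (le_autSup M)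
      · simp only [S', Function.update_of_ne hij]
        exact inf_le_left.trans (hMS i (by omega))
    · intro T C hC hR hTN
      have hT := hrad T C hC hR hTN
      have hfn : ∀ i : Fin T.weight, (if i.1 < j + 1 then S' i.1 else M').Normal := by
        intro i
        split_ifs
        · have := hS'c i.1; infer_instance
        · exact hM'.nor
      have hfn0 : ∀ i : Fin T.weight, (if i.1 < j then S i.1 else M).Normal := by
        intro i
        split_ifs
        · have := hSc i.1; infer_instance
        · exact hM.nor
      have hn := sub_normal T _ hfn
      have hn0 := sub_normal T _ hfn0
      by_cases hw : T.weight ≤ j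
      · refine rad_mono hC hR hn (sub_mono _ _ _ fun i => ?_) hT
        have := i.2
        rw [if_pos (by omega), if_pos (by omega)]
        simp only [S']
        rw [Function.update_of_ne (by omega)]
      · let W := T.sub fun i => if i.1 < j then S i.1 else M
        have hle : (T.sub fun i => if i.1 < j + 1 then S' i.1 else M') ≤
            ⨆ k : F, T.sub fun i => (if i.1 < j then S i.1 else M).map k.1.toMonoidHom := by
          refine sub_iSup_le T _ _ hfn (fun k i => map_normal (hfn0 i) k.1)
            ⟨j, by omega⟩ ?_ ?_
          · simp only [S', lt_irrefl, if_false, Nat.lt_succ_self, if_true, Function.update_self]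
            rw [hF]
            exact Finset.sup_le fun φ hφ =>
              le_iSup (fun k : F => M.map k.1.toMonoidHom) ⟨φ, hφ⟩
          · intro k i hi
            have hi' : i.1 ≠ j := fun e => hi (Fin.ext e)
            by_cases hij : i.1 < j
            · rw [if_pos (by omega), if_pos hij]
              simp only [S']
              rw [Function.update_of_ne hi']
              exact (Subgroup.characteristic_iff_map_eq.1 (hSc i.1) k.1).ge
            · rw [if_neg (by omega), if_neg hij]
              exact hM'F k.1 k.2
        have hle2 : (⨆ k : F, T.sub fun i => (if i.1 < j then S i.1 else M).map k.1.toMonoidHom) ≤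
            F.sup fun φ => W.map φ.toMonoidHom := by
          refine iSup_le fun k => ?_
          rw [← sub_map]
          exact Finset.le_sup (f := fun φ : G ≃* G => W.map φ.toMonoidHom) k.2
        refine rad_mono hC hR hn (hle.trans hle2) (rad_fsup hC hR _
          (fun φ => map_normal hn0 φ) F (rad_mono hC hR inferInstance bot_le hT) ?_).1
        intro φ _
        exact hC _ _ (W.equivMapOfInjective φ.toMonoidHom φ.injective) hT

end helpers

/-- **Large-subgroup theorem.** If `N ⊴ G` and `G/N` satisfies the maximal condition on
normal subgroups, then for every `t ≥ 1` there is a characteristic subgroup `H` of `G`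
lying in the sublattice generated by the automorphic images of `N`, whose quotient `G/H`
lies in every formation containing `G/N`, and such that for every outer commutator word `w`
of weight at most `t`, the subgroup `w(H,…,H)` lies in every radical class containing
`w(N,…,N)`. -/
theorem stmt_7 {G : Type u} [Group G] (N : Subgroup G) [hN : N.Normal]
    (hmax : ∀ S : Set (Subgroup (G ⧸ N)), S.Nonempty → (∀ K ∈ S, K.Normal) →
      ∃ K ∈ S, ∀ K' ∈ S, K ≤ K' → K' = K)
    {t : ℕ} (ht : 1 ≤ t) :
    ∃ H : Subgroup G, H.Characteristic ∧
      (∀ S : Set (Subgroup G), (∀ φ : G ≃* G, N.map φ.toMonoidHom ∈ S) →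
        (∀ a ∈ S, ∀ b ∈ S, a ⊔ b ∈ S) → (∀ a ∈ S, ∀ b ∈ S, a ⊓ b ∈ S) → H ∈ S) ∧
      ∃ hHn : H.Normal,
        (∀ C : GroupClass.{u}, IsoClosed C → IsFormation C →
          quotLies C N hN → quotLies C H hHn) ∧
        (∀ T : CTree, T.weight ≤ t → ∀ C : GroupClass.{u}, IsoClosed C →
          IsRadicalClass C → C ↥(T.sub fun _ => N) → C ↥(T.sub fun _ => H)) := by
  obtain ⟨S, M, hM, hSc, hMS, hrad⟩ := steps N hN (MaxN.base hmax) t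
  have hch := autSup_char M
  have hnor : (autSup M).Normal := inferInstance
  refine ⟨autSup M, hch, ?_, hnor, ?_, ?_⟩
  · obtain ⟨F, hF⟩ := autSup_finite hM.nor hM.max
    rw [hF]
    exact fsup_lat hM.lat F
  · intro C hC hF hq
    exact form_mono hC hF hM.nor hnor (le_autSup M) (hM.form C hC hF hq)
  · intro T hT C hC hR hTN
    refine rad_mono hC hR (sub_normal T _ fun _ => hnor) (sub_mono T _ _ fun i => ?_)
      (hrad T C hC hR hTN)
    have hi : i.1 < t := lt_of_lt_of_le i.2 hT
    rw [if_pos hi]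
    refine iSup_le fun φ => ?_
    exact (Subgroup.map_mono (hMS i.1 hi)).trans
      (Subgroup.characteristic_iff_map_eq.1 (hSc i.1) φ).le
end

section
/- Let G be a group and let n ≥ 0 be an integer. Suppose G has a subgroup N of finite index such that the n-th derived subgroup of N is a torsion group (every element of the n-th term of the derived series of N has finite order). Then G has a characteristic subgroup H of finite index such that the n-th derived subgroup of H is a torsion group. -/
open Subgroup in
/-- Multilinear derived commutator of a sequence of subgroups. -/
def DD {G : Type*} [Group G] : ℕ → (ℕ → Subgroup G) → Subgroup G
  | 0, f => f 0
  | n + 1, f => ⁅DD n f, DD n (fun i => f (i + 2 ^ n))⁆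

section aux
variable {G : Type*} [Group G]

theorem DD_normal (n : ℕ) : ∀ (f : ℕ → Subgroup G), (∀ i, (f i).Normal) → (DD n f).Normal := by
  induction n with
  | zero => intro f h; exact h 0
  | succ n ih =>
    intro f h
    have h1 := ih f h
    have h2 := ih (fun i => f (i + 2 ^ n)) (fun i => h _)
    exact Subgroup.commutator_normal _ _

theorem DD_mono (n : ℕ) : ∀ (f g : ℕ → Subgroup G), (∀ i, i < 2 ^ n → f i ≤ g i) →
    DD n f ≤ DD n g := by
  induction n with
  | zero => intro f g h; exact h 0 (by simp)
  | succ n ih =>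
    intro f g h
    refine Subgroup.commutator_mono (ih _ _ fun i hi => h i ?_) (ih _ _ fun i hi => h _ ?_)
    · rw [pow_succ]; omega
    · rw [pow_succ]; omega

theorem DD_map {G' : Type*} [Group G'] (φ : G →* G') (n : ℕ) : ∀ (f : ℕ → Subgroup G),
    (DD n f).map φ = DD n (fun i => (f i).map φ) := by
  induction n with
  | zero => intro f; rfl
  | succ n ih =>
    intro f
    simp only [DD, Subgroup.map_commutator, ih]

theorem DD_const (H : Subgroup G) (n : ℕ) :
    (derivedSeries H n).map H.subtype = DD n (fun _ => H) := by
  induction n with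
  | zero => simp [DD, derivedSeries_zero, ← MonoidHom.range_eq_map]
  | succ n ih => simp only [DD, derivedSeries_succ, Subgroup.map_commutator, ih]

open scoped commutatorElement in
theorem comm_sup_le (A B C : Subgroup G) [A.Normal] [B.Normal] [C.Normal] :
    ⁅A ⊔ B, C⁆ ≤ ⁅A, C⁆ ⊔ ⁅B, C⁆ := by
  rw [Subgroup.commutator_le]
  intro x hx c hc
  obtain ⟨a, ha, b, hb, rfl⟩ := Subgroup.mem_sup_of_normal_left.1 hx
  have : ⁅a * b, c⁆ = (a * ⁅b, c⁆ * a⁻¹) * ⁅a, c⁆ := by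
    simp only [commutatorElement_def]; group
  rw [this]
  have hn : (⁅B, C⁆ : Subgroup G).Normal := inferInstance
  exact mul_mem (Subgroup.mem_sup_right (hn.conj_mem _ (Subgroup.commutator_mem_commutator hb hc) _))
    (Subgroup.mem_sup_left (Subgroup.commutator_mem_commutator ha hc))

theorem DD_sup (n : ℕ) : ∀ (f : ℕ → Subgroup G) (k : ℕ) (A B : Subgroup G), (∀ i, (f i).Normal) →
    k < 2 ^ n → A.Normal → B.Normal →
    DD n (Function.update f k (A ⊔ B)) ≤
      DD n (Function.update f k A) ⊔ DD n (Function.update f k B) := by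
  induction n with
  | zero =>
    intro f k A B hf hk hA hB
    obtain rfl : k = 0 := by simpa using hk
    simp [DD]
  | succ n ih =>
    intro f k A B hf hk hA hB
    have hnorm : ∀ X : Subgroup G, X.Normal → ∀ j i, (Function.update f j X i).Normal := by
      intro X hX j i
      by_cases h : i = j
      · subst h; simpa using hX
      · simpa [h] using hf i
    have hnorm' : ∀ X : Subgroup G, X.Normal → ∀ j i,
        (Function.update (fun i => f (i + 2 ^ n)) j X i).Normal := by
      intro X hX j i
      by_cases h : i = j
      · subst h; simpa using hX
      · simpa [h] using hf _
    by_cases hkn : k < 2 ^ n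
    · have e : ∀ X : Subgroup G, (fun i => Function.update f k X (i + 2 ^ n)) =
          fun i => f (i + 2 ^ n) := by
        intro X; funext i
        rw [Function.update_of_ne]; omega
      simp only [DD, e]
      have i1 := DD_normal n _ (hnorm A hA k)
      have i2 := DD_normal n _ (hnorm B hB k)
      have i3 := DD_normal n (fun i => f (i + 2 ^ n)) (fun i => hf _)
      exact (Subgroup.commutator_mono (ih f k A B hf hkn hA hB) le_rfl).trans (comm_sup_le _ _ _)
    · have hk' : k - 2 ^ n < 2 ^ n := by rw [pow_succ] at hk; omega
      have e : ∀ X : Subgroup G, (fun i => Function.update f k X (i + 2 ^ n)) =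
          Function.update (fun i => f (i + 2 ^ n)) (k - 2 ^ n) X := by
        intro X; funext i
        by_cases h : i = k - 2 ^ n
        · have : i + 2 ^ n = k := by omega
          rw [h, Function.update_self, ← h, this, Function.update_self]
        · rw [Function.update_of_ne h, Function.update_of_ne]; omega
      have e0 : ∀ X : Subgroup G, DD n (Function.update f k X) = DD n f := by
        intro X
        apply le_antisymm <;> refine DD_mono n _ _ fun i hi => ?_ <;>
          rw [Function.update_of_ne (by omega)]
      simp only [DD, e, e0]
      have i1 := DD_normal n _ (hnorm' A hA (k - 2 ^ n))
      have i2 := DD_normal n _ (hnorm' B hB (k - 2 ^ n))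
      have i3 := DD_normal n f hf
      rw [Subgroup.commutator_comm (DD n f), Subgroup.commutator_comm (DD n f),
        Subgroup.commutator_comm (DD n f)]
      exact (Subgroup.commutator_mono (ih _ _ A B (fun i => hf _) hk' hA hB) le_rfl).trans
        (comm_sup_le _ _ _)

theorem tors_sup (A B : Subgroup G) [A.Normal] (hA : ∀ x ∈ A, IsOfFinOrder x)
    (hB : ∀ x ∈ B, IsOfFinOrder x) : ∀ x ∈ A ⊔ B, IsOfFinOrder x := by
  intro x hx
  obtain ⟨a, ha, b, hb, rfl⟩ := Subgroup.mem_sup_of_normal_left.1 hx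
  obtain ⟨m, hm, hbm⟩ := isOfFinOrder_iff_pow_eq_one.1 (hB b hb)
  have : (a * b) ^ m ∈ A := by
    rw [← QuotientGroup.eq_one_iff]
    have h1 : ((a : G) : G ⧸ A) = 1 := (QuotientGroup.eq_one_iff a).2 ha
    rw [QuotientGroup.mk_pow, QuotientGroup.mk_mul, h1, one_mul, ← QuotientGroup.mk_pow, hbm]
    rfl
  exact (isOfFinOrder_pow.1 (hA _ this)).resolve_right hm.ne'

theorem exists_radical (G : Type*) [Group G] : ∃ T : Subgroup G, T.Characteristic ∧
    (∀ x ∈ T, IsOfFinOrder x) ∧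
    ∀ M : Subgroup G, M.Normal → (∀ x ∈ M, IsOfFinOrder x) → M ≤ T := by
  let S : Set (Subgroup G) := {M | M.Normal ∧ ∀ x ∈ M, IsOfFinOrder x}
  have hle : ∀ M : Subgroup G, M.Normal → (∀ x ∈ M, IsOfFinOrder x) → M ≤ sSup S :=
    fun M h1 h2 => le_sSup ⟨h1, h2⟩
  refine ⟨sSup S, ?_, ?_, hle⟩
  · rw [Subgroup.characteristic_iff_map_le]
    intro φ
    rw [Subgroup.map_le_iff_le_comap]
    refine sSup_le ?_
    rintro M ⟨h1, h2⟩
    rw [← Subgroup.map_le_iff_le_comap]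
    refine hle _ (h1.map _ φ.surjective) ?_
    rintro _ ⟨x, hx, rfl⟩
    exact MonoidHom.isOfFinOrder _ (h2 x hx)
  · have hne : S.Nonempty := ⟨⊥, inferInstance, by
      intro x hx; rw [Subgroup.mem_bot.1 hx]; exact IsOfFinOrder.one⟩
    have hd : DirectedOn (· ≤ ·) S := by
      rintro A ⟨hA, hA'⟩ B ⟨hB, hB'⟩
      exact ⟨A ⊔ B, ⟨inferInstance, tors_sup A B hA' hB'⟩, le_sup_left, le_sup_right⟩
    intro x hx
    obtain ⟨M, hM, hxM⟩ := (Subgroup.mem_sSup_of_directedOn hne hd).1 hx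
    exact hM.2 x hxM

theorem map_finiteIndex (K : Subgroup G) [hK : K.FiniteIndex] (φ : G ≃* G) :
    (K.map φ.toMonoidHom).FiniteIndex := by
  constructor
  rw [Subgroup.index_map_of_bijective φ.bijective]
  exact hK.index_ne_zero

theorem exists_finset (K : Subgroup G) [K.FiniteIndex] : ∃ s : Finset (G ≃* G),
    (1 : G ≃* G) ∈ s ∧ (s.sup fun φ => K.map φ.toMonoidHom).Characteristic := by
  classical
  let M : Finset (G ≃* G) → Subgroup G := fun s => s.sup fun φ => K.map φ.toMonoidHom
  have hK : ∀ s, (1 : G ≃* G) ∈ s → K ≤ M s := by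
    intro s hs
    have h1 : K ≤ K.map (1 : G ≃* G).toMonoidHom := fun x hx => ⟨x, hx, rfl⟩
    exact h1.trans (Finset.le_sup (f := fun φ : G ≃* G => K.map φ.toMonoidHom) hs)
  let P : ℕ → Prop := fun m => ∃ s, (1 : G ≃* G) ∈ s ∧ (M s).index = m
  have hP : ∃ m, P m := ⟨_, {1}, by simp, rfl⟩
  obtain ⟨s, hs, hm⟩ := Nat.find_spec hP
  have key : ∀ φ : G ≃* G, K.map φ.toMonoidHom ≤ M s := by
    intro φ
    have h1 : M s ≤ M (insert φ s) := Finset.sup_mono (Finset.subset_insert _ _)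
    have h2 : Nat.find hP ≤ (M (insert φ s)).index :=
      Nat.find_min' hP ⟨_, Finset.mem_insert_of_mem hs, rfl⟩
    have hfi : (M s).FiniteIndex := Subgroup.finiteIndex_of_le (hK s hs)
    have h3 : M s = M (insert φ s) := by
      by_contra hne
      have := Subgroup.index_strictAnti (lt_of_le_of_ne h1 hne)
      omega
    rw [h3]
    exact Finset.le_sup (f := fun φ : G ≃* G => K.map φ.toMonoidHom) (Finset.mem_insert_self φ s)
  refine ⟨s, hs, ?_⟩
  rw [Subgroup.characteristic_iff_map_le]
  intro ψ
  rw [Subgroup.map_le_iff_le_comap]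
  refine Finset.sup_le fun φ _ => ?_
  rw [← Subgroup.map_le_iff_le_comap, Subgroup.map_map]
  exact key (φ.trans ψ)

theorem step (n : ℕ) (T : Subgroup G) (hT : T.Characteristic) (N : Subgroup G)
    (hN : N.Normal) (hNf : N.FiniteIndex) (h0 : DD n (fun _ => N) ≤ T) (k : ℕ) (hk : k ≤ 2 ^ n) :
    ∃ H K : Subgroup G, H.Characteristic ∧ H.FiniteIndex ∧ K.Normal ∧ K.FiniteIndex ∧
      DD n (fun i => if i < k then H else K) ≤ T := by
  classical
  induction k with
  | zero => exact ⟨⊤, N, inferInstance, inferInstance, hN, hNf, by simpa using h0⟩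
  | succ k ih =>
    obtain ⟨H, K, hH, hHf, hK, hKf, hD⟩ := ih (by omega)
    obtain ⟨s, hs, hM⟩ := exists_finset K
    set M := s.sup fun φ : G ≃* G => K.map φ.toMonoidHom with hMdef
    let L := s.inf fun φ : G ≃* G => K.map φ.toMonoidHom
    have h1 : K ≤ K.map (1 : G ≃* G).toMonoidHom := fun x hx => ⟨x, hx, rfl⟩
    have hKM : K ≤ M :=
      h1.trans
        (Finset.le_sup (f := fun φ : G ≃* G => K.map φ.toMonoidHom) hs)
    have hMf : M.FiniteIndex := Subgroup.finiteIndex_of_le hKM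
    have hmn : ∀ φ : G ≃* G, (K.map φ.toMonoidHom).Normal := fun φ => hK.map _ φ.surjective
    have hLn : L.Normal :=
      Finset.inf_induction (p := Subgroup.Normal) inferInstance
        (fun a ha b hb => by infer_instance) (fun φ _ => hmn φ)
    have hLf : L.FiniteIndex :=
      Finset.inf_induction (p := Subgroup.FiniteIndex) inferInstance
        (fun a ha b hb => by infer_instance) (fun φ _ => map_finiteIndex K φ)
    have hHM : (H ⊓ M).Characteristic := by
      rw [Subgroup.characteristic_iff_le_comap] at *
      intro φ
      rw [Subgroup.comap_inf]
      exact inf_le_inf (hH φ) (hM φ)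
    refine ⟨H ⊓ M, L, hHM, inferInstance, hLn, hLf, ?_⟩
    let f : ℕ → Subgroup G := fun i => if i < k then H else L
    have hf : ∀ i, (f i).Normal := by
      intro i; simp only [f]; split_ifs <;> infer_instance
    have one : ∀ φ ∈ s, DD n (Function.update f k (K.map φ.toMonoidHom)) ≤ T := by
      intro φ hφ
      have h1 : (DD n (fun i => if i < k then H else K)).map φ.toMonoidHom ≤ T :=
        (Subgroup.map_mono hD).trans (Subgroup.characteristic_iff_map_le.1 hT φ)
      rw [DD_map] at h1
      refine (DD_mono n _ _ fun i _ => ?_).trans h1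
      have hLK : L ≤ K.map φ.toMonoidHom := Finset.inf_le hφ
      by_cases hik : i = k
      · subst hik; simp
      · rw [Function.update_of_ne hik]
        simp only [f]
        split_ifs
        · exact (Subgroup.characteristic_iff_map_eq.1 hH φ).ge
        · exact hLK
    have all : ∀ X : Subgroup G, X = M → DD n (Function.update f k X) ≤ T := by
      rintro _ rfl
      have : M.Normal ∧ DD n (Function.update f k M) ≤ T := by
        refine Finset.sup_induction (p := fun X : Subgroup G => X.Normal ∧
          DD n (Function.update f k X) ≤ T) ⟨inferInstance, ?_⟩ ?_ fun φ hφ => ⟨hmn φ, one φ hφ⟩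
        · refine (DD_mono n _ _ fun i _ => ?_).trans (one 1 hs)
          by_cases hik : i = k
          · subst hik; simp
          · simp [hik]
        · rintro A ⟨hA, hA'⟩ B ⟨hB, hB'⟩
          exact ⟨inferInstance, (DD_sup n f k A B hf (by omega) hA hB).trans (sup_le hA' hB')⟩
      exact this.2
    refine (DD_mono n _ _ fun i _ => ?_).trans (all M rfl)
    by_cases hik : i = k
    · subst hik; simp
    · rw [Function.update_of_ne hik]
      simp only [f]
      split_ifs <;> first | omega | exact inf_le_left | exact le_rfl

end aux


/-- If a group `G` has a finite-index subgroup `N` whose `n`-th derived subgroup is a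
torsion group, then `G` has a characteristic finite-index subgroup `H` whose `n`-th derived
subgroup is a torsion group. -/
theorem stmt_10 {G : Type*} [Group G] (n : ℕ) (N : Subgroup G) (hNfin : N.FiniteIndex)
    (htors : ∀ x : ↥N, x ∈ derivedSeries ↥N n → IsOfFinOrder x) :
    ∃ H : Subgroup G, H.Characteristic ∧ H.FiniteIndex ∧
      ∀ x : ↥H, x ∈ derivedSeries ↥H n → IsOfFinOrder x := by
  obtain ⟨T, hT, hTt, hTmax⟩ := exists_radical G
  have h0 : DD n (fun _ => N.normalCore) ≤ T := by
    refine hTmax _ (DD_normal n _ fun _ => inferInstance) fun x hx => ?_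
    have hx' := DD_mono n _ (fun _ => N) (fun _ _ => N.normalCore_le) hx
    rw [← DD_const] at hx'
    obtain ⟨y, hy, rfl⟩ := hx'
    exact MonoidHom.isOfFinOrder _ (htors y hy)
  obtain ⟨H, K, hH, hHf, -, -, hD⟩ :=
    step n T hT N.normalCore inferInstance inferInstance h0 (2 ^ n) le_rfl
  refine ⟨H, hH, hHf, fun x hx => ?_⟩
  have h1 : (x : G) ∈ DD n (fun _ => H) := by
    rw [← DD_const]; exact ⟨x, hx, rfl⟩
  have h2 : (x : G) ∈ T := hD (DD_mono n _ _ (fun i hi => by simp [hi]) h1)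
  exact Submonoid.isOfFinOrder_coe.1 (hTt _ h2)
end
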